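/- For every k ≥ 0, the class of bar (1,k)-visibility graphs is not closed under path-addition: there exist a bar (1,k)-visibility graph G, distinct vertices u, v of G, and a path P of length at least |V(G)|−1 from u to v whose internal vertices are new, such that for every supplementary edge set F the graph G ⊕ P ⊕ F is not a bar (1,k)-visibility graph, or some finite sequence of path-additions starting from a bar (1,k)-visibility graph produces a graph outside the class. -/

import Mathlib

/-- Points of the plane `ℝ²`. -/
abbrev Plane : Type := ℝ × ℝ

/-- The `i`-th vertex of a path from `a` to `b` whose internal vertices are
`w 0, …, w (t-1)` (so the path has length `t + 1`). -/
def chainVertex {α : Type*} (a b : α) {t : ℕ} (w : Fin t → α) (i : Fin (t + 2)) : α :=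
  if _h0 : (i : ℕ) = 0 then a
  else if _h1 : (i : ℕ) = t + 1 then b
  else w ⟨(i : ℕ) - 1, by have := i.isLt; omega⟩

/-- The edge set of a path from `a` to `b` through the internal vertices
`w 0, …, w (t-1)`. -/
def chainEdges {α : Type*} (a b : α) {t : ℕ} (w : Fin t → α) : Set (Sym2 α) :=
  {e | ∃ i : Fin (t + 1),
    e = s(chainVertex a b w (Fin.castSucc i), chainVertex a b w (Fin.succ i))}

/-- Path-addition `G ⊕ P ⊕ F`: the graph on `V ⊕ Fin t` obtained from `G` by adding an
internally vertex-disjoint path `P = (u, w₁, …, w_t, v)` with `t` new internal vertices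
together with a set `F` of supplementary edges. -/
def pathAdd {V : Type*} (G : SimpleGraph V) (u v : V) (t : ℕ)
    (F : Set (Sym2 (V ⊕ Fin t))) : SimpleGraph (V ⊕ Fin t) :=
  SimpleGraph.fromEdgeSet
    ((Sym2.map Sum.inl '' G.edgeSet)
      ∪ chainEdges (Sum.inl u) (Sum.inl v) (fun i => Sum.inr i)
      ∪ F)

/-- A valid supplementary edge set: every supplementary edge is a non-loop with at least
one endpoint among the internal vertices `w₁, …, w_t` of the added path. -/
def ValidSupp {V : Type*} {t : ℕ} (F : Set (Sym2 (V ⊕ Fin t))) : Prop :=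
  ∀ e ∈ F, ¬ e.IsDiag ∧ ∃ i : Fin t, Sum.inr i ∈ e

/-- The horizontal bar with x-range `[lo, hi]` at height `y`. -/
def hBar (lo hi y : ℝ) : Set Plane := Set.Icc lo hi ×ˢ ({y} : Set ℝ)

/-- A (weak) bar (1,k)-visibility representation of `G`: a bar 1-visibility
representation (pairwise disjoint horizontal bars, each edge a vertical line of sight
whose interior intersects the bars of at most one vertex other than its endpoints) in
which moreover the bar of each vertex is intersected in its interior by at most `k` of
the chosen lines of sight. -/
structure Bar1kVisRep {V : Type*} (G : SimpleGraph V) (k : ℕ) where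
  lo : V → ℝ
  hi : V → ℝ
  yc : V → ℝ
  lo_le_hi : ∀ x : V, lo x ≤ hi x
  bars_disjoint : ∀ x y : V, x ≠ y →
    Disjoint (hBar (lo x) (hi x) (yc x)) (hBar (lo y) (hi y) (yc y))
  /-- the x-coordinate of the vertical line of sight chosen for each edge -/
  sight : Sym2 V → ℝ
  sight_on_bars : ∀ x y : V, G.Adj x y →
    sight s(x, y) ∈ Set.Icc (lo x) (hi x) ∧ sight s(x, y) ∈ Set.Icc (lo y) (hi y)
  sight_one_bar : ∀ x y : V, G.Adj x y →
    {z : V | z ≠ x ∧ z ≠ y ∧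
      ((({sight s(x, y)} : Set ℝ) ×ˢ Set.Ioo (min (yc x) (yc y)) (max (yc x) (yc y))) ∩
        hBar (lo z) (hi z) (yc z)).Nonempty}.Subsingleton
  bar_crossed_at_most : ∀ z : V,
    {e : Sym2 V | ∃ x y : V, e = s(x, y) ∧ G.Adj x y ∧
      ((({sight e} : Set ℝ) ×ˢ Set.Ioo (min (yc x) (yc y)) (max (yc x) (yc y))) ∩
        hBar (lo z) (hi z) (yc z)).Nonempty}.ncard ≤ k

/-- A graph is a (weak) bar (1,k)-visibility graph if it admits a bar (1,k)-visibility
representation. -/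
def IsBar1kVisibilityGraph {V : Type*} (G : SimpleGraph V) (k : ℕ) : Prop :=
  Nonempty (Bar1kVisRep G k)


/-! ### Core parity argument (a van Kampen type obstruction for `K₅`) -/

/-- Indicator of `a < b` modulo 2. -/
noncomputable def ltZ {L : Type*} [LinearOrder L] (a b : L) : ZMod 2 :=
  open Classical in if a < b then 1 else 0

lemma ltZ_swap {L : Type*} [LinearOrder L] {a b : L} (h : a ≠ b) :
    ltZ a b + ltZ b a = 1 := by
  unfold ltZ
  rcases lt_or_gt_of_ne h with h | h
  · simp [h, h.not_gt]
  · simp [h, h.not_gt]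

/-- Parity of sights of a walk passing to the right of the bar `z`. -/
noncomputable def RZ {W L : Type*} [LinearOrder L] (y : W → L) (hi : W → ℝ)
    (e : ℕ → W) (x : ℕ → ℝ) (m : ℕ) (z : W) : ZMod 2 :=
  ∑ i ∈ Finset.range m, ltZ (hi z) (x i) * (ltZ (y (e i)) (y z) + ltZ (y (e (i + 1))) (y z))

/-- Parity of sights of a walk passing to the left of the bar `z`. -/
noncomputable def LZ {W L : Type*} [LinearOrder L] (y : W → L) (lo : W → ℝ)
    (e : ℕ → W) (x : ℕ → ℝ) (m : ℕ) (z : W) : ZMod 2 :=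
  ∑ i ∈ Finset.range m, ltZ (x i) (lo z) * (ltZ (y (e i)) (y z) + ltZ (y (e (i + 1))) (y z))

/-- `z` lies strictly between `a` and `b`. -/
def StrictBtwn {L : Type*} [LinearOrder L] (a b z : L) : Prop := (a < z ∧ z < b) ∨ (b < z ∧ z < a)

lemma zmod2_add_self (a : ZMod 2) : a + a = 0 := CharTwo.add_self_eq_zero a

lemma cover_eq_zero {L : Type*} [LinearOrder L] {a b z : L} (ha : a ≠ z) (hb : b ≠ z)
    (h : ¬ StrictBtwn a b z) : ltZ a z + ltZ b z = 0 := by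
  unfold StrictBtwn at h
  unfold ltZ
  rcases lt_or_gt_of_ne ha with h1 | h1 <;> rcases lt_or_gt_of_ne hb with h2 | h2
  · simp [h1, h2]; decide
  · exact absurd (Or.inl ⟨h1, h2⟩) h
  · exact absurd (Or.inr ⟨h2, h1⟩) h
  · simp [h1.not_gt, h2.not_gt]

lemma telescope2 (g : ℕ → ZMod 2) (m : ℕ) :
    ∑ i ∈ Finset.range m, (g i + g (i + 1)) = g 0 + g m := by
  induction m with
  | zero => simp [zmod2_add_self]
  | succ n ih =>
    rw [Finset.sum_range_succ, ih]
    linear_combination zmod2_add_self (g n)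

lemma R_add_L {W L : Type*} [LinearOrder L] (y : W → L) (lo hi : W → ℝ)
    (e : ℕ → W) (x : ℕ → ℝ) (m : ℕ) (z : W) (hz : lo z ≤ hi z)
    (hne : ∀ i ≤ m, y (e i) ≠ y z)
    (hnc : ∀ i < m, StrictBtwn (y (e i)) (y (e (i + 1))) (y z) → ¬ (lo z ≤ x i ∧ x i ≤ hi z)) :
    RZ y hi e x m z + LZ y lo e x m z = ltZ (y (e 0)) (y z) + ltZ (y (e m)) (y z) := by
  rw [← telescope2 (fun i => ltZ (y (e i)) (y z)) m]
  unfold RZ LZ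
  rw [← Finset.sum_add_distrib]
  refine Finset.sum_congr rfl fun i hi' => ?_
  have him := Finset.mem_range.1 hi'
  by_cases hb : StrictBtwn (y (e i)) (y (e (i + 1))) (y z)
  · have h := hnc i him hb
    have h1 : ltZ (hi z) (x i) + ltZ (x i) (lo z) = 1 := by
      unfold ltZ
      by_cases h2 : hi z < x i
      · have : ¬ x i < lo z := by linarith
        simp [h2, this]
      · have : x i < lo z := by
          by_contra h3
          exact h ⟨by linarith, by linarith⟩
        simp [h2, this]
    rw [← add_mul, h1, one_mul]
  · rw [cover_eq_zero (hne i him.le) (hne (i + 1) him) hb]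
    simp

lemma R_eq_L {W L : Type*} [LinearOrder L] (y : W → L) (lo hi : W → ℝ)
    (e : ℕ → W) (x : ℕ → ℝ) (m : ℕ) (f : ℕ → W) (x' : ℕ → ℝ) (n : ℕ)
    (hne : ∀ i ≤ m, ∀ j ≤ n, y (e i) ≠ y (f j))
    (hx : ∀ i < m, (lo (e i) ≤ x i ∧ x i ≤ hi (e i)) ∧
      (lo (e (i + 1)) ≤ x i ∧ x i ≤ hi (e (i + 1))))
    (hx' : ∀ i < n, (lo (f i) ≤ x' i ∧ x' i ≤ hi (f i)) ∧
      (lo (f (i + 1)) ≤ x' i ∧ x' i ≤ hi (f (i + 1))))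
    (hef : ∀ i < m, ∀ j ≤ n, StrictBtwn (y (e i)) (y (e (i + 1))) (y (f j)) →
      ¬ (lo (f j) ≤ x i ∧ x i ≤ hi (f j)))
    (hfe : ∀ j < n, ∀ i ≤ m, StrictBtwn (y (f j)) (y (f (j + 1))) (y (e i)) →
      ¬ (lo (e i) ≤ x' j ∧ x' j ≤ hi (e i))) :
    RZ y hi e x m (f 0) + RZ y hi e x m (f n) =
      LZ y lo f x' n (e 0) + LZ y lo f x' n (e m) := by
  rw [← telescope2 (fun j => RZ y hi e x m (f j)) n]
  unfold LZ
  rw [← Finset.sum_add_distrib]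
  refine Finset.sum_congr rfl fun j hj => ?_
  have hjn := Finset.mem_range.1 hj
  -- step 1: replace the right end of `f j` by the sight
  have step1 : ∀ j' ≤ n, lo (f j') ≤ x' j → x' j ≤ hi (f j') →
      RZ y hi e x m (f j') = ∑ i ∈ Finset.range m,
        ltZ (x' j) (x i) * (ltZ (y (e i)) (y (f j')) + ltZ (y (e (i + 1))) (y (f j'))) := by
    intro j' hj' hl hh
    refine Finset.sum_congr rfl fun i hi' => ?_
    have him := Finset.mem_range.1 hi'
    by_cases hb : StrictBtwn (y (e i)) (y (e (i + 1))) (y (f j'))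
    · have h := hef i him j' hj' hb
      congr 1
      unfold ltZ
      by_cases h2 : hi (f j') < x i
      · have : x' j < x i := by linarith
        simp [h2, this]
      · have : ¬ x' j < x i := by
          intro h3
          exact h ⟨by linarith, by linarith⟩
        simp [h2, this]
    · rw [cover_eq_zero (hne i him.le j' hj') (hne (i + 1) him j' hj') hb]
      simp
  have hb' := hx' j hjn
  rw [step1 j hjn.le hb'.1.1 hb'.1.2, step1 (j + 1) hjn hb'.2.1 hb'.2.2,
    ← Finset.sum_add_distrib]
  rw [← telescope2 (fun i => ltZ (x' j) (lo (e i)) *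
    (ltZ (y (f j)) (y (e i)) + ltZ (y (f (j + 1))) (y (e i)))) m]
  refine Finset.sum_congr rfl fun i hi' => ?_
  have him := Finset.mem_range.1 hi'
  have key : ∀ i' ≤ m, lo (e i') ≤ x i → x i ≤ hi (e i') →
      ltZ (x' j) (x i) * (ltZ (y (e i')) (y (f j)) + ltZ (y (e i')) (y (f (j + 1)))) =
      ltZ (x' j) (lo (e i')) * (ltZ (y (f j)) (y (e i')) + ltZ (y (f (j + 1))) (y (e i'))) := by
    intro i' hi'm hl hh
    have s1 := ltZ_swap (hne i' hi'm j hjn.le)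
    have s2 := ltZ_swap (hne i' hi'm (j + 1) hjn)
    have s3 : ltZ (y (e i')) (y (f j)) + ltZ (y (e i')) (y (f (j + 1))) =
        ltZ (y (f j)) (y (e i')) + ltZ (y (f (j + 1))) (y (e i')) := by
      linear_combination s1 + s2 + zmod2_add_self 1
        - zmod2_add_self (ltZ (y (f j)) (y (e i'))) -
        zmod2_add_self (ltZ (y (f (j + 1))) (y (e i')))
    rw [s3]
    by_cases hb : StrictBtwn (y (f j)) (y (f (j + 1))) (y (e i'))
    · have h := hfe j hjn i' hi'm hb
      congr 1
      unfold ltZ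
      by_cases h2 : x' j < lo (e i')
      · have : x' j < x i := by linarith
        simp [h2, this]
      · have : ¬ x' j < x i := by
          intro h3
          exact h ⟨by linarith, by linarith⟩
        simp [h2, this]
    · rw [cover_eq_zero (hne i' hi'm j hjn.le).symm (hne i' hi'm (j + 1) hjn).symm hb]
      simp
  have hb := hx i him
  have k1 := key i him.le hb.1.1 hb.1.2
  have k2 := key (i + 1) him hb.2.1 hb.2.2
  linear_combination k1 + k2

lemma RR_eq {W L : Type*} [LinearOrder L] (y : W → L) (lo hi : W → ℝ)
    (hlh : ∀ z, lo z ≤ hi z)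
    (e : ℕ → W) (x : ℕ → ℝ) (m : ℕ) (f : ℕ → W) (x' : ℕ → ℝ) (n : ℕ)
    (hne : ∀ i ≤ m, ∀ j ≤ n, y (e i) ≠ y (f j))
    (hx : ∀ i < m, (lo (e i) ≤ x i ∧ x i ≤ hi (e i)) ∧
      (lo (e (i + 1)) ≤ x i ∧ x i ≤ hi (e (i + 1))))
    (hx' : ∀ i < n, (lo (f i) ≤ x' i ∧ x' i ≤ hi (f i)) ∧
      (lo (f (i + 1)) ≤ x' i ∧ x' i ≤ hi (f (i + 1))))
    (hef : ∀ i < m, ∀ j ≤ n, StrictBtwn (y (e i)) (y (e (i + 1))) (y (f j)) →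
      ¬ (lo (f j) ≤ x i ∧ x i ≤ hi (f j)))
    (hfe : ∀ j < n, ∀ i ≤ m, StrictBtwn (y (f j)) (y (f (j + 1))) (y (e i)) →
      ¬ (lo (e i) ≤ x' j ∧ x' j ≤ hi (e i))) :
    RZ y hi e x m (f 0) + RZ y hi e x m (f n) + RZ y hi f x' n (e 0) + RZ y hi f x' n (e m) =
      ltZ (y (f 0)) (y (e 0)) + ltZ (y (f n)) (y (e 0)) +
      (ltZ (y (f 0)) (y (e m)) + ltZ (y (f n)) (y (e m))) := by
  have h1 := R_eq_L y lo hi e x m f x' n hne hx hx' hef hfe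
  have h2 := R_add_L y lo hi f x' n (e 0) (hlh _) (fun j hj => (hne 0 (Nat.zero_le _) j hj).symm)
    (fun j hj => hfe j hj 0 (Nat.zero_le _))
  have h3 := R_add_L y lo hi f x' n (e m) (hlh _) (fun j hj => (hne m le_rfl j hj).symm)
    (fun j hj => hfe j hj m le_rfl)
  linear_combination h1 + h2 + h3

/-- The `K₅` parity contradiction. -/
lemma k5_parity (T : Fin 5 × Fin 5 → Fin 5 → ZMod 2) (l : Fin 5 → Fin 5 → ZMod 2)
    (hl : ∀ i j, i < j → l j i = l i j + 1)
    (h : ∀ a b c d : Fin 5, a < b → c < d → a < c → b ≠ c → b ≠ d →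
      T (a, b) c + T (a, b) d + T (c, d) a + T (c, d) b =
        l c a + l d a + (l c b + l d b)) : False := by
  have e1 := h 0 1 2 3 (by decide) (by decide) (by decide) (by decide) (by decide)
  have e2 := h 0 1 2 4 (by decide) (by decide) (by decide) (by decide) (by decide)
  have e3 := h 0 1 3 4 (by decide) (by decide) (by decide) (by decide) (by decide)
  have e4 := h 0 2 1 3 (by decide) (by decide) (by decide) (by decide) (by decide)
  have e5 := h 0 2 1 4 (by decide) (by decide) (by decide) (by decide) (by decide)
  have e6 := h 0 2 3 4 (by decide) (by decide) (by decide) (by decide) (by decide)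
  have e7 := h 0 3 1 2 (by decide) (by decide) (by decide) (by decide) (by decide)
  have e8 := h 0 3 1 4 (by decide) (by decide) (by decide) (by decide) (by decide)
  have e9 := h 0 3 2 4 (by decide) (by decide) (by decide) (by decide) (by decide)
  have e10 := h 0 4 1 2 (by decide) (by decide) (by decide) (by decide) (by decide)
  have e11 := h 0 4 1 3 (by decide) (by decide) (by decide) (by decide) (by decide)
  have e12 := h 0 4 2 3 (by decide) (by decide) (by decide) (by decide) (by decide)
  have e13 := h 1 2 3 4 (by decide) (by decide) (by decide) (by decide) (by decide)
  have e14 := h 1 3 2 4 (by decide) (by decide) (by decide) (by decide) (by decide)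
  have e15 := h 1 4 2 3 (by decide) (by decide) (by decide) (by decide) (by decide)
  rw [hl 0 2 (by decide), hl 0 3 (by decide), hl 1 2 (by decide), hl 1 3 (by decide)] at e1
  rw [hl 0 2 (by decide), hl 0 4 (by decide), hl 1 2 (by decide), hl 1 4 (by decide)] at e2
  rw [hl 0 3 (by decide), hl 0 4 (by decide), hl 1 3 (by decide), hl 1 4 (by decide)] at e3
  rw [hl 0 1 (by decide), hl 0 3 (by decide), hl 2 3 (by decide)] at e4
  rw [hl 0 1 (by decide), hl 0 4 (by decide), hl 2 4 (by decide)] at e5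
  rw [hl 0 3 (by decide), hl 0 4 (by decide), hl 2 3 (by decide), hl 2 4 (by decide)] at e6
  rw [hl 0 1 (by decide), hl 0 2 (by decide)] at e7
  rw [hl 0 1 (by decide), hl 0 4 (by decide), hl 3 4 (by decide)] at e8
  rw [hl 0 2 (by decide), hl 0 4 (by decide), hl 3 4 (by decide)] at e9
  rw [hl 0 1 (by decide), hl 0 2 (by decide)] at e10
  rw [hl 0 1 (by decide), hl 0 3 (by decide)] at e11
  rw [hl 0 2 (by decide), hl 0 3 (by decide)] at e12
  rw [hl 1 3 (by decide), hl 1 4 (by decide), hl 2 3 (by decide), hl 2 4 (by decide)] at e13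
  rw [hl 1 2 (by decide), hl 1 4 (by decide), hl 3 4 (by decide)] at e14
  rw [hl 1 2 (by decide), hl 1 3 (by decide)] at e15
  have two : (2 : ZMod 2) = 0 := by decide
  have : (1 : ZMod 2) = 0 := by
    linear_combination (norm := (ring_nf; reduce_mod_char))
      e1 + e2 + e3 + e4 + e5 + e6 + e7 + e8 + e9 + e10 + e11 + e12 + e13 + e14 + e15
  exact absurd this (by decide)

/-! ### Representations: crossings, restriction, pigeonhole -/

/-- The sight of the (potential) edge `xy` crosses the bar `z`. -/
def Bar1kVisRep.Cr {V : Type*} {G : SimpleGraph V} {k : ℕ} (r : Bar1kVisRep G k)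
    (x y z : V) : Prop :=
  (r.lo z ≤ r.sight s(x, y) ∧ r.sight s(x, y) ≤ r.hi z) ∧
    min (r.yc x) (r.yc y) < r.yc z ∧ r.yc z < max (r.yc x) (r.yc y)

lemma cross_iff (a lo hi z p q : ℝ) :
    ((({a} : Set ℝ) ×ˢ Set.Ioo p q) ∩ hBar lo hi z).Nonempty ↔
      (lo ≤ a ∧ a ≤ hi) ∧ p < z ∧ z < q := by
  constructor
  · rintro ⟨⟨s, t⟩, h1, h2⟩
    simp only [hBar, Set.mem_prod, Set.mem_singleton_iff, Set.mem_Ioo, Set.mem_Icc] at h1 h2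
    obtain ⟨rfl, h3⟩ := h1
    obtain ⟨h4, rfl⟩ := h2
    exact ⟨h4, h3⟩
  · rintro ⟨h1, h2⟩
    exact ⟨(a, z), by simpa [hBar] using ⟨h2, h1⟩⟩

lemma disj_iff {lo hi z lo' hi' z' : ℝ} (h : Disjoint (hBar lo hi z) (hBar lo' hi' z'))
    (hz : z = z') (a : ℝ) (h1 : lo ≤ a ∧ a ≤ hi) (h2 : lo' ≤ a ∧ a ≤ hi') : False := by
  have m1 : ((a, z) : Plane) ∈ hBar lo hi z := by simpa [hBar] using h1
  have m2 : ((a, z) : Plane) ∈ hBar lo' hi' z' := by simpa [hBar, hz] using h2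
  exact Set.disjoint_left.1 h m1 m2

/-- Restriction of a representation along an injective homomorphism. -/
def Bar1kVisRep.restrict {V W : Type} [Finite W] {G : SimpleGraph V} {H : SimpleGraph W} {k : ℕ}
    (r : Bar1kVisRep H k) (ι : V ↪ W) (hι : ∀ x y, G.Adj x y → H.Adj (ι x) (ι y)) :
    Bar1kVisRep G k where
  lo x := r.lo (ι x)
  hi x := r.hi (ι x)
  yc x := r.yc (ι x)
  lo_le_hi x := r.lo_le_hi _
  bars_disjoint x y h := r.bars_disjoint _ _ (fun h' => h (ι.injective h'))
  sight e := r.sight (Sym2.map ι e)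
  sight_on_bars x y h := r.sight_on_bars _ _ (hι x y h)
  sight_one_bar x y h := by
    intro z hz z' hz'
    apply ι.injective
    refine r.sight_one_bar _ _ (hι x y h) ?_ ?_
    · exact ⟨fun h' => hz.1 (ι.injective h'), fun h' => hz.2.1 (ι.injective h'), hz.2.2⟩
    · exact ⟨fun h' => hz'.1 (ι.injective h'), fun h' => hz'.2.1 (ι.injective h'), hz'.2.2⟩
  bar_crossed_at_most z := by
    refine le_trans ?_ (r.bar_crossed_at_most (ι z))
    refine Set.ncard_le_ncard_of_injOn (Sym2.map ι) ?_ ?_ (Set.toFinite _)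
    · rintro e ⟨x, y, rfl, h, hc⟩
      exact ⟨ι x, ι y, rfl, hι x y h, hc⟩
    · exact (Sym2.map.injective ι.injective).injOn

/-- `P 0, …, P m` is a walk from `a` to `b`. -/
def IsWlk {V : Type*} (G : SimpleGraph V) (a b : V) (m : ℕ) (P : ℕ → V) : Prop :=
  P 0 = a ∧ P m = b ∧ ∀ j < m, G.Adj (P j) (P (j + 1))

/-- Closedness of the class under path-addition. -/
def ClosedPA (k : ℕ) : Prop :=
  ∀ (V : Type) (iV : Fintype V) (G : SimpleGraph V), IsBar1kVisibilityGraph G k →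
    ∀ u v : V, u ≠ v → ∀ t : ℕ, @Fintype.card V iV - 1 ≤ t + 1 →
      ∃ F : Set (Sym2 (V ⊕ Fin t)), IsBar1kVisibilityGraph (pathAdd G u v t F) k

lemma pathAdd_walk {V : Type*} (G : SimpleGraph V) (u v : V) (t : ℕ) (ht : 1 ≤ t)
    (F : Set (Sym2 (V ⊕ Fin t))) :
    ∃ P : ℕ → V ⊕ Fin t, IsWlk (pathAdd G u v t F) (Sum.inl u) (Sum.inl v) (t + 1) P ∧
      ∀ j, 0 < j → j < t + 1 → ∃ i, P j = Sum.inr i := by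
  refine ⟨fun j => if h : j < t + 2 then
    chainVertex (Sum.inl u) (Sum.inl v) (fun i : Fin t => Sum.inr i) ⟨j, h⟩ else Sum.inl v,
    ⟨?_, ?_, ?_⟩, ?_⟩
  · simp [chainVertex]
  · simp [chainVertex]
  · intro j hj
    have h1 : j < t + 2 := by omega
    have h2 : j + 1 < t + 2 := by omega
    simp only [h1, h2, dif_pos]
    unfold pathAdd
    rw [SimpleGraph.fromEdgeSet_adj]
    refine ⟨Or.inl (Or.inr ⟨⟨j, hj⟩, rfl⟩), ?_⟩
    unfold chainVertex
    by_cases h0 : j = 0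
    · subst h0
      have : ¬ (t = 0) := by omega
      simp [this]
    · have h3 : ¬ j = t + 1 := by omega
      by_cases h4 : j = t
      · have h5 : ¬ t = 0 := by omega
        simp [h4, h5]
      · simp [h0, h3, h4]
        omega
  · intro j h0 hj
    have h1 : j < t + 2 := by omega
    have h2 : ¬ j = 0 := by omega
    have h3 : ¬ j = t + 1 := by omega
    exact ⟨⟨j - 1, by omega⟩, by simp [chainVertex, h1, h2, h3]⟩

lemma add_many {k : ℕ} (hc : ClosedPA k) {V : Type} [Fintype V] (G : SimpleGraph V)
    (hG : IsBar1kVisibilityGraph G k) (u v : V) (huv : u ≠ v) (N : ℕ) :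
    ∃ (W : Type) (_ : Fintype W) (H : SimpleGraph W) (ι : V ↪ W) (c : W → ℕ),
      IsBar1kVisibilityGraph H k ∧ (∀ x y, G.Adj x y → H.Adj (ι x) (ι y)) ∧
      (∀ x, c (ι x) = 0) ∧
      ∀ i, 1 ≤ i → i ≤ N → ∃ (m : ℕ) (P : ℕ → W), 2 ≤ m ∧ IsWlk H (ι u) (ι v) m P ∧
        ∀ j, 0 < j → j < m → c (P j) = i := by
  induction N with
  | zero =>
    exact ⟨V, inferInstance, G, Function.Embedding.refl V, fun _ => 0, hG, fun _ _ h => h,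
      fun _ => rfl, fun i h1 h2 => by omega⟩
  | succ N ih =>
    obtain ⟨W, iW, H, ι, c, hH, hadj, hc0, hp⟩ := ih
    obtain ⟨F, hF⟩ := hc W iW H hH (ι u) (ι v) (fun h => huv (ι.injective h))
      (Fintype.card W) (by omega)
    have hcard : 1 ≤ Fintype.card W := Fintype.card_pos_iff.2 ⟨ι u⟩
    have hemb : ∀ x y, H.Adj x y →
        (pathAdd H (ι u) (ι v) (Fintype.card W) F).Adj (Sum.inl x) (Sum.inl y) := by
      intro x y h
      unfold pathAdd
      rw [SimpleGraph.fromEdgeSet_adj]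
      refine ⟨Or.inl (Or.inl ⟨s(x, y), h, rfl⟩), ?_⟩
      intro h'
      exact h.ne (Sum.inl_injective h')
    refine ⟨W ⊕ Fin (Fintype.card W), inferInstance, _, ι.trans Function.Embedding.inl,
      Sum.elim c (fun _ => N + 1), hF, fun x y h => hemb _ _ (hadj x y h), fun x => hc0 x, ?_⟩
    intro i h1 h2
    rcases Nat.lt_or_ge N i with h3 | h3
    · have hi : i = N + 1 := by omega
      obtain ⟨P, hP, hP'⟩ := pathAdd_walk H (ι u) (ι v) (Fintype.card W) hcard F
      refine ⟨_, P, by omega, hP, ?_⟩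
      intro j h0 hj
      obtain ⟨q, hq⟩ := hP' j h0 hj
      rw [hq, hi]; rfl
    · obtain ⟨m, P, hm, hP, hP'⟩ := hp i h1 h3
      refine ⟨m, fun j => Sum.inl (P j), hm, ⟨?_, ?_, ?_⟩, ?_⟩
      · simp [hP.1]
      · simp [hP.2.1]
      · intro j hj
        exact hemb _ _ (hP.2.2 j hj)
      · intro j h0 hj
        exact hP' j h0 hj

lemma exists_good_color {k : ℕ} {V W : Type} [Fintype V] [Fintype W] {G : SimpleGraph V}
    {H : SimpleGraph W} (ι : V ↪ W) (c : W → ℕ)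
    (hadj : ∀ x y, G.Adj x y → H.Adj (ι x) (ι y)) (r : Bar1kVisRep H k) :
    ∃ i, 1 ≤ i ∧ i ≤ Fintype.card V * k + Fintype.card (V × V) * 1 + 1 ∧
      (∀ x a b, H.Adj a b → max (c a) (c b) = i → ¬ r.Cr a b (ι x)) ∧
      (∀ x y z, G.Adj x y → c z = i → ¬ r.Cr (ι x) (ι y) z) := by
  classical
  set N := Fintype.card V * k + Fintype.card (V × V) * 1 + 1 with hN
  let mx : Sym2 W → ℕ := Sym2.lift ⟨fun a b => max (c a) (c b), fun a b => max_comm _ _⟩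
  let A : V → Set (Sym2 W) := fun x => {e : Sym2 W | ∃ a b : W, e = s(a, b) ∧ H.Adj a b ∧
      ((({r.sight e} : Set ℝ) ×ˢ Set.Ioo (min (r.yc a) (r.yc b)) (max (r.yc a) (r.yc b))) ∩
        hBar (r.lo (ι x)) (r.hi (ι x)) (r.yc (ι x))).Nonempty}
  let B : V × V → Set W := fun p => {z | G.Adj p.1 p.2 ∧ r.Cr (ι p.1) (ι p.2) z}
  let S1 : Finset ℕ := Finset.univ.biUnion fun x => (Set.toFinite (A x)).toFinset.image mx
  let S2 : Finset ℕ := Finset.univ.biUnion fun p => (Set.toFinite (B p)).toFinset.image c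
  have h1 : S1.card ≤ Fintype.card V * k := by
    refine Finset.card_biUnion_le_card_mul _ _ _ fun x _ => ?_
    refine Finset.card_image_le.trans ?_
    rw [← Set.ncard_eq_toFinset_card]
    exact r.bar_crossed_at_most (ι x)
  have h2 : S2.card ≤ Fintype.card (V × V) * 1 := by
    refine Finset.card_biUnion_le_card_mul _ _ _ fun p _ => ?_
    refine Finset.card_image_le.trans ?_
    rw [Finset.card_le_one]
    intro z hz z' hz'
    rw [Set.Finite.mem_toFinset] at hz hz'
    have aux : ∀ w, w ∈ B p → w ∈ {z : W | z ≠ ι p.1 ∧ z ≠ ι p.2 ∧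
      ((({r.sight s(ι p.1, ι p.2)} : Set ℝ) ×ˢ Set.Ioo (min (r.yc (ι p.1)) (r.yc (ι p.2)))
        (max (r.yc (ι p.1)) (r.yc (ι p.2)))) ∩
        hBar (r.lo z) (r.hi z) (r.yc z)).Nonempty} := by
      rintro w ⟨-, hw⟩
      refine ⟨?_, ?_, (cross_iff _ _ _ _ _ _).2 hw⟩
      · rintro rfl
        obtain ⟨-, q1, q2⟩ := hw
        rcases le_total (r.yc (ι p.1)) (r.yc (ι p.2)) with h | h
        · rw [min_eq_left h] at q1; exact lt_irrefl _ q1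
        · rw [max_eq_left h] at q2; exact lt_irrefl _ q2
      · rintro rfl
        obtain ⟨-, q1, q2⟩ := hw
        rcases le_total (r.yc (ι p.1)) (r.yc (ι p.2)) with h | h
        · rw [max_eq_right h] at q2; exact lt_irrefl _ q2
        · rw [min_eq_right h] at q1; exact lt_irrefl _ q1
    exact r.sight_one_bar _ _ (hadj _ _ hz.1) (aux z hz) (aux z' hz')
  have h3 : (S1 ∪ S2).card < (Finset.Icc 1 N).card := by
    rw [Nat.card_Icc]
    have := Finset.card_union_le S1 S2
    omega
  obtain ⟨i, hi, hni⟩ := Finset.exists_mem_notMem_of_card_lt_card h3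
  rw [Finset.mem_Icc] at hi
  rw [Finset.mem_union, not_or] at hni
  refine ⟨i, hi.1, hi.2, ?_, ?_⟩
  · intro x a b hab hm hcr
    apply hni.1
    refine Finset.mem_biUnion.2 ⟨x, Finset.mem_univ _, Finset.mem_image.2 ⟨s(a, b), ?_, hm⟩⟩
    rw [Set.Finite.mem_toFinset]
    exact ⟨a, b, rfl, hab, (cross_iff _ _ _ _ _ _).2 hcr⟩
  · intro x y z hxy hz hcr
    apply hni.2
    refine Finset.mem_biUnion.2 ⟨(x, y), Finset.mem_univ _, Finset.mem_image.2 ⟨z, ?_, hz⟩⟩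
    rw [Set.Finite.mem_toFinset]
    exact ⟨hxy, hcr⟩

/-- Every representation of `G` contains pairwise non-crossing walks joining
the pairs of terminals in `ps`. -/
def GoodSys {V : Type} (G : SimpleGraph V) (k : ℕ) (τ : Fin 5 → V)
    (ps : List (Fin 5 × Fin 5)) : Prop :=
  ∀ r : Bar1kVisRep G k, ∃ (m : Fin 5 × Fin 5 → ℕ) (P : Fin 5 × Fin 5 → ℕ → V),
    (∀ p ∈ ps, IsWlk G (τ p.1) (τ p.2) (m p) (P p) ∧
      (∀ i, i ≠ p.1 → i ≠ p.2 → ∀ j ≤ m p, P p j ≠ τ i) ∧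
      (∀ i, ∀ j < m p, ¬ r.Cr (P p j) (P p (j + 1)) (τ i))) ∧
    ∀ p ∈ ps, ∀ q ∈ ps, p.1 ≠ q.1 → p.1 ≠ q.2 → p.2 ≠ q.1 → p.2 ≠ q.2 →
      (∀ i ≤ m p, ∀ j ≤ m q, P p i ≠ P q j) ∧
      (∀ i < m p, ∀ j ≤ m q, ¬ r.Cr (P p i) (P p (i + 1)) (P q j))

lemma good_step {k : ℕ} (hc : ClosedPA k) {V : Type} [Fintype V] (G : SimpleGraph V)
    (hG : IsBar1kVisibilityGraph G k) (τ : Fin 5 → V) (hτ : Function.Injective τ)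
    (ps : List (Fin 5 × Fin 5)) (hgood : GoodSys G k τ ps) (p : Fin 5 × Fin 5)
    (hp : p.1 ≠ p.2) (hps : p ∉ ps) :
    ∃ (W : Type) (_ : Fintype W) (H : SimpleGraph W) (σ : Fin 5 → W),
      IsBar1kVisibilityGraph H k ∧ Function.Injective σ ∧ GoodSys H k σ (p :: ps) := by
  classical
  obtain ⟨W, iW, H, ι, c, hH, hadj, hc0, hpath⟩ := add_many hc G hG (τ p.1) (τ p.2)
    (fun h => hp (hτ h)) (Fintype.card V * k + Fintype.card (V × V) * 1 + 1)
  refine ⟨W, iW, H, fun i => ι (τ i), hH, ι.injective.comp hτ, ?_⟩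
  intro r
  obtain ⟨i, hi1, hiN, hgc1, hgc2⟩ := exists_good_color ι c hadj r
  obtain ⟨m₀, P₀, hm₀, hP₀, hcol⟩ := hpath i hi1 hiN
  obtain ⟨m, P, hA, hB⟩ := hgood (r.restrict ι hadj)
  have hrc : ∀ x y z, (r.restrict ι hadj).Cr x y z ↔ r.Cr (ι x) (ι y) (ι z) :=
    fun x y z => Iff.rfl
  -- the new walk crosses no old bar
  have hnew : ∀ x, ∀ j < m₀, ¬ r.Cr (P₀ j) (P₀ (j + 1)) (ι x) := by
    intro x j hj
    refine hgc1 x _ _ (hP₀.2.2 j hj) ?_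
    rcases Nat.eq_zero_or_pos j with h0 | h0
    · subst h0
      rw [hP₀.1, hc0, hcol 1 (by omega) (by omega)]
      omega
    · rw [hcol j h0 hj]
      rcases Nat.lt_or_ge (j + 1) m₀ with h1 | h1
      · rw [hcol (j + 1) (by omega) h1]; omega
      · have : j + 1 = m₀ := by omega
        rw [this, hP₀.2.1, hc0]; omega
  -- vertices of the new walk
  have hvert : ∀ j ≤ m₀, P₀ j = ι (τ p.1) ∨ P₀ j = ι (τ p.2) ∨ c (P₀ j) = i := by
    intro j hj
    rcases Nat.eq_zero_or_pos j with h0 | h0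
    · left; rw [h0, hP₀.1]
    · rcases Nat.lt_or_ge j m₀ with h1 | h1
      · right; right; exact hcol j h0 h1
      · have : j = m₀ := by omega
        right; left; rw [this, hP₀.2.1]
  refine ⟨Function.update m p m₀, Function.update (fun q j => ι (P q j)) p P₀, ?_, ?_⟩
  · intro q hq
    rcases List.mem_cons.1 hq with rfl | hq
    · simp only [Function.update_self]
      refine ⟨hP₀, ?_, fun i' j hj => hnew _ j hj⟩
      intro i' h1 h2 j hj heq
      rcases hvert j hj with h | h | h
      · rw [h] at heq; exact h1 (hτ (ι.injective heq)).symm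
      · rw [h] at heq; exact h2 (hτ (ι.injective heq)).symm
      · rw [heq, hc0] at h; omega
    · have hne : q ≠ p := fun h => hps (h ▸ hq)
      simp only [Function.update_of_ne hne]
      obtain ⟨⟨a1, a2, a3⟩, a4, a5⟩ := hA q hq
      refine ⟨⟨congrArg ι a1, congrArg ι a2, fun j hj => hadj _ _ (a3 j hj)⟩, ?_, ?_⟩
      · intro i' h1 h2 j hj heq
        exact a4 i' h1 h2 j hj (ι.injective heq)
      · intro i' j hj
        exact a5 i' j hj
  · intro q hq q' hq' d1 d2 d3 d4
    rcases List.mem_cons.1 hq with hqp | hq1 <;> rcases List.mem_cons.1 hq' with hqp' | hq1'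
    · exact absurd (hqp.trans hqp'.symm ▸ rfl) d1
    · subst hqp
      have hne : q' ≠ q := fun h => hps (h ▸ hq1')
      simp only [Function.update_self, Function.update_of_ne hne]
      refine ⟨?_, fun i' hi' j hj => hnew _ i' hi'⟩
      intro i' hi' j hj heq
      rcases hvert i' hi' with h | h | h
      · rw [h] at heq
        exact (hA q' hq1').2.1 _ d1 d2 j hj (ι.injective heq).symm
      · rw [h] at heq
        exact (hA q' hq1').2.1 _ d3 d4 j hj (ι.injective heq).symm
      · rw [heq, hc0] at h; omega
    · subst hqp'
      have hne : q ≠ q' := fun h => hps (h ▸ hq1)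
      simp only [Function.update_self, Function.update_of_ne hne]
      refine ⟨?_, ?_⟩
      · intro i' hi' j hj heq
        rcases hvert j hj with h | h | h
        · rw [h] at heq
          exact (hA q hq1).2.1 _ (Ne.symm d1) (Ne.symm d3) i' hi' (ι.injective heq)
        · rw [h] at heq
          exact (hA q hq1).2.1 _ (Ne.symm d2) (Ne.symm d4) i' hi' (ι.injective heq)
        · rw [← heq, hc0] at h; omega
      · intro i' hi' j hj
        rcases hvert j hj with h | h | h
        · rw [h]; exact (hA q hq1).2.2 _ i' hi'
        · rw [h]; exact (hA q hq1).2.2 _ i' hi'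
        · exact hgc2 _ _ _ ((hA q hq1).1.2.2 i' hi') h
    · have hne : q ≠ p := fun h => hps (h ▸ hq1)
      have hne' : q' ≠ p := fun h => hps (h ▸ hq1')
      simp only [Function.update_of_ne hne, Function.update_of_ne hne']
      obtain ⟨b1, b2⟩ := hB q hq1 q' hq1' d1 d2 d3 d4
      refine ⟨?_, fun i' hi' j hj => b2 i' hi' j hj⟩
      intro i' hi' j hj heq
      exact b1 i' hi' j hj (ι.injective heq)

lemma good_all {k : ℕ} (hc : ClosedPA k) (ps : List (Fin 5 × Fin 5)) (hnd : ps.Nodup)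
    (hps : ∀ p ∈ ps, p.1 ≠ p.2) :
    ∃ (W : Type) (_ : Fintype W) (H : SimpleGraph W) (σ : Fin 5 → W),
      IsBar1kVisibilityGraph H k ∧ Function.Injective σ ∧ GoodSys H k σ ps := by
  induction ps with
  | nil =>
    refine ⟨Fin 5, inferInstance, ⊥, id, ⟨?_⟩, Function.injective_id, ?_⟩
    · exact
        { lo := fun _ => 0
          hi := fun _ => 0
          yc := fun i => (i : ℕ)
          lo_le_hi := fun _ => le_rfl
          bars_disjoint := by
            intro x y hxy
            rw [Set.disjoint_left]
            rintro ⟨a, b⟩ h1 h2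
            simp only [hBar, Set.mem_prod, Set.mem_singleton_iff] at h1 h2
            have h3 : ((x : ℕ) : ℝ) = ((y : ℕ) : ℝ) := h1.2.symm.trans h2.2
            exact hxy (Fin.ext (by exact_mod_cast h3))
          sight := fun _ => 0
          sight_on_bars := fun x y h => absurd h (by simp)
          sight_one_bar := fun x y h => absurd h (by simp)
          bar_crossed_at_most := by intro z; simp }
    · intro r
      exact ⟨fun _ => 0, fun _ _ => 0, by simp, by simp⟩
  | cons p ps ih =>
    rw [List.nodup_cons] at hnd
    obtain ⟨W, iW, H, σ, hH, hσ, hg⟩ := ih hnd.2 (fun q hq => hps q (List.mem_cons_of_mem _ hq))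
    exact good_step hc H hH σ hσ ps hg p (hps p List.mem_cons_self) hnd.1

/-- Rank of a bar: heights, with ties broken by left endpoints. -/
noncomputable def Bar1kVisRep.rk {V : Type*} {G : SimpleGraph V} {k : ℕ} (r : Bar1kVisRep G k)
    (x : V) : ℝ ×ₗ ℝ := toLex (r.yc x, r.lo x)

lemma rk_inj {V : Type*} {G : SimpleGraph V} {k : ℕ} (r : Bar1kVisRep G k) {x y : V}
    (h : x ≠ y) : r.rk x ≠ r.rk y := by
  intro h'
  have h1 : (r.yc x, r.lo x) = (r.yc y, r.lo y) := toLex.injective h'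
  rw [Prod.mk.injEq] at h1
  exact disj_iff (r.bars_disjoint x y h) h1.1 (r.lo x) ⟨le_rfl, r.lo_le_hi x⟩
    ⟨h1.2 ▸ le_rfl, h1.2 ▸ r.lo_le_hi y⟩

lemma no_cross_rk {V : Type*} {G : SimpleGraph V} {k : ℕ} (r : Bar1kVisRep G k) {x y z : V}
    (hxy : G.Adj x y) (hx : x ≠ z) (hy : y ≠ z) (hcr : ¬ r.Cr x y z)
    (hb : StrictBtwn (r.rk x) (r.rk y) (r.rk z)) :
    ¬ (r.lo z ≤ r.sight s(x, y) ∧ r.sight s(x, y) ≤ r.hi z) := by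
  intro hs
  have hon := r.sight_on_bars x y hxy
  have n1 : r.yc x ≠ r.yc z := fun h => disj_iff (r.bars_disjoint x z hx) h _ hon.1 hs
  have n2 : r.yc y ≠ r.yc z := fun h => disj_iff (r.bars_disjoint y z hy) h _ hon.2 hs
  apply hcr
  refine ⟨hs, ?_⟩
  have hlt : ∀ a b : V, r.rk a < r.rk b → r.yc a ≤ r.yc b := by
    intro a b h
    rcases Prod.Lex.toLex_lt_toLex.1 h with h | h
    · exact h.le
    · exact h.1.le
  rcases hb with ⟨h1, h2⟩ | ⟨h1, h2⟩
  · have a1 := lt_of_le_of_ne (hlt _ _ h1) n1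
    have a2 := lt_of_le_of_ne (hlt _ _ h2) n2.symm
    exact ⟨min_lt_of_left_lt a1, lt_max_of_lt_right a2⟩
  · have a1 := lt_of_le_of_ne (hlt _ _ h1) n2
    have a2 := lt_of_le_of_ne (hlt _ _ h2) n1.symm
    exact ⟨min_lt_of_right_lt a1, lt_max_of_lt_left a2⟩

lemma not_closedPA (k : ℕ) : ¬ ClosedPA k := by
  intro hc
  obtain ⟨W, iW, H, σ, ⟨r⟩, hσ, hg⟩ := good_all hc
    [(0, 1), (0, 2), (0, 3), (0, 4), (1, 2), (1, 3), (1, 4), (2, 3), (2, 4), (3, 4)]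
    (by decide) (by decide)
  have hmem : ∀ a b : Fin 5, a < b → (a, b) ∈ ([(0, 1), (0, 2), (0, 3), (0, 4), (1, 2), (1, 3),
    (1, 4), (2, 3), (2, 4), (3, 4)] : List (Fin 5 × Fin 5)) := by decide
  obtain ⟨m, P, hA, hB⟩ := hg r
  let X : Fin 5 × Fin 5 → ℕ → ℝ := fun p j => r.sight s(P p j, P p (j + 1))
  refine k5_parity (fun p i => RZ r.rk r.hi (P p) (X p) (m p) (σ i))
    (fun i j => ltZ (r.rk (σ i)) (r.rk (σ j))) ?_ ?_
  · intro i j hij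
    have := ltZ_swap (rk_inj r (fun h => hij.ne (hσ h)))
    linear_combination this - zmod2_add_self (ltZ (r.rk (σ i)) (r.rk (σ j)))
  · intro a b c d hab hcd hac hbc hbd
    have hp := hmem a b hab
    have hq := hmem c d hcd
    have had : a ≠ d := (hac.trans hcd).ne
    obtain ⟨⟨p0, pm, padj⟩, -, -⟩ := hA _ hp
    obtain ⟨⟨q0, qm, qadj⟩, -, -⟩ := hA _ hq
    obtain ⟨v1, c1⟩ := hB _ hp _ hq hac.ne had hbc hbd
    obtain ⟨v2, c2⟩ := hB _ hq _ hp hac.ne' hbc.symm had.symm hbd.symm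
    have := RR_eq r.rk r.lo r.hi r.lo_le_hi (P (a, b)) (X (a, b)) (m (a, b))
      (P (c, d)) (X (c, d)) (m (c, d))
      (fun i hi j hj => rk_inj r (v1 i hi j hj))
      (fun i hi => r.sight_on_bars _ _ (padj i hi))
      (fun i hi => r.sight_on_bars _ _ (qadj i hi))
      (fun i hi j hj => no_cross_rk r (padj i hi) (v1 i hi.le j hj) (v1 (i + 1) hi j hj)
        (c1 i hi j hj))
      (fun i hi j hj => no_cross_rk r (qadj i hi) (v2 i hi.le j hj) (v2 (i + 1) hi j hj)
        (c2 i hi j hj))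
    rw [p0, pm, q0, qm] at this
    exact this

/-- For every `k ≥ 0` the class of bar (1,k)-visibility graphs is not
closed under path-addition: there are a bar (1,k)-visibility graph `G`, distinct vertices
`u, v`, and a path of length at least `|V(G)| - 1` with new internal vertices such that
for every supplementary edge set the resulting graph is not a bar (1,k)-visibility
graph. -/
theorem bar1kVisibility_not_closedUnderPathAddition (k : ℕ) :
    ∃ (V : Type) (iV : Fintype V) (G : SimpleGraph V),
      IsBar1kVisibilityGraph G k ∧
      ∃ u v : V, u ≠ v ∧
        ∃ t : ℕ, @Fintype.card V iV - 1 ≤ t + 1 ∧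
          ∀ F : Set (Sym2 (V ⊕ Fin t)), ValidSupp F →
            ¬ IsBar1kVisibilityGraph (pathAdd G u v t F) k := by
  by_contra hcon
  push Not at hcon
  refine not_closedPA k fun V iV G hG u v huv t ht => ?_
  obtain ⟨F, -, hF⟩ := hcon V iV G hG u v huv t ht
  exact ⟨F, hF⟩
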